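/- arXiv:2209.10936 — 2 statements merged into one kernel-verified Lean document; each statement's English description precedes it below -/
import Mathlib

section
/- Let X_P be a standard Pareto random variable, B an independent random variable uniform on {-1,1}, Y = 2 - B/X_P, and let X_L and Y_L be the Laplace-scale transforms of X_P and Y. Then for every real z with z ∉ {-1/2, 1/2}, lim_{t→∞} P(Y_L · e^{X_L} ≤ z | X_L > t) equals 0 if z < -1/2, equals 1/2 if -1/2 < z < 1/2, and equals 1 if z > 1/2; that is, conditionally on X_L > t the randomly normalised variable Y_L e^{X_L} converges in distribution as t → ∞ to a random variable taking the values -1/2 and 1/2 each with probability 1/2. -/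
open MeasureTheory ProbabilityTheory Filter Set

/-- Inverse CDF of the standard Laplace distribution. -/
noncomputable def lapInv (p : ℝ) : ℝ :=
  if p ≤ 1/2 then Real.log (2 * p) else -Real.log (2 * (1 - p))

theorem lapInv_one_sub_inv {x : ℝ} (hx : 2 < x) : lapInv (1 - 1 / x) = Real.log (x / 2) := by
  have hx0 : 0 < x := by linarith
  have h : 1 / x < 1 / 2 := one_div_lt_one_div_of_lt two_pos hx
  rw [lapInv, if_neg (by linarith), ← Real.log_inv]
  congr 1
  field_simp
  ring

theorem lapInv_le_zero {x : ℝ} (hx1 : 1 < x) (hx : x ≤ 2) : lapInv (1 - 1 / x) ≤ 0 := by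
  have hx0 : 0 < x := by linarith
  have h : 1 / 2 ≤ 1 / x := one_div_le_one_div_of_le hx0 hx
  have h' : 1 / x < 1 := (div_lt_one hx0).2 hx1
  rw [lapInv, if_pos (by linarith)]
  exact Real.log_nonpos (by linarith) (by linarith)

/-- The event that the Laplace transform of a Pareto value exceeds `t ≥ 0`. -/
theorem lt_lapInv_iff {x t : ℝ} (hx1 : 1 < x) (ht : 0 ≤ t) :
    t < lapInv (1 - 1 / x) ↔ 2 * Real.exp t < x := by
  have he : 1 ≤ Real.exp t := Real.one_le_exp ht
  rcases lt_or_ge 2 x with hx | hx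
  · rw [lapInv_one_sub_inv hx, Real.lt_log_iff_exp_lt (by linarith), lt_div_iff₀ two_pos, mul_comm]
  · have := lapInv_le_zero hx1 hx
    constructor <;> intro h <;> linarith

theorem tendsto_half_mul_log_one_sub_inv :
    Tendsto (fun x : ℝ => Real.log (1 - 1 / x) * (x / 2)) atTop (nhds (-(1 / 2))) := by
  have h := (Real.tendsto_mul_log_one_add_div_atTop (-1)).mul_const (1 / 2)
  refine (h.congr fun x => ?_).trans (by norm_num)
  rw [neg_div, ← sub_eq_add_neg]
  ring

section Pareto

variable {Ω : Type*} [MeasurableSpace Ω] {μ : Measure Ω} {X : Ω → ℝ}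

theorem ae_one_lt_of_pareto
    (hX : ∀ x : ℝ, μ {ω | X ω ≤ x} = if x < 1 then 0 else ENNReal.ofReal (1 - 1 / x)) :
    ∀ᵐ ω ∂μ, 1 < X ω := by
  have h := hX 1
  simp only [lt_irrefl, if_false, div_one, sub_self, ENNReal.ofReal_zero] at h
  simpa [ae_iff] using h

theorem measureReal_le_of_pareto
    (hX : ∀ x : ℝ, μ {ω | X ω ≤ x} = if x < 1 then 0 else ENNReal.ofReal (1 - 1 / x))
    {x : ℝ} (hx : 1 ≤ x) : μ.real {ω | X ω ≤ x} = 1 - 1 / x := by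
  have h : 1 / x ≤ 1 := (div_le_one (by linarith)).2 hx
  rw [measureReal_def, hX, if_neg (not_lt.2 hx), ENNReal.toReal_ofReal (by linarith)]

theorem measureReal_sign_inter {B : Ω → ℝ} (hindep : IndepFun B X μ) {b : ℝ}
    (hb : μ {ω | B ω = b} = 1 / 2) {S : Set ℝ} (hS : MeasurableSet S) :
    μ.real ({ω | B ω = b} ∩ X ⁻¹' S) = 1 / 2 * μ.real (X ⁻¹' S) := by
  have h := hindep.measure_inter_preimage_eq_mul {b} S (measurableSet_singleton b) hS
  change μ ({ω | B ω = b} ∩ X ⁻¹' S) = μ {ω | B ω = b} * _ at h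
  rw [measureReal_def, h, hb, ENNReal.toReal_mul, measureReal_def]
  simp

variable {B Y : Ω → ℝ}

theorem cdf_two_sub_inv
    (hX : ∀ x : ℝ, μ {ω | X ω ≤ x} = if x < 1 then 0 else ENNReal.ofReal (1 - 1 / x))
    (hBvals : ∀ ω, B ω = -1 ∨ B ω = 1) (hB1 : μ {ω | B ω = 1} = 1 / 2)
    (hindep : IndepFun B X μ) (hY : ∀ ω, Y ω = 2 - B ω / X ω) {x : ℝ} (hx : 1 < x) :
    μ.real {ω | Y ω ≤ 2 - 1 / x} = 1 / 2 * (1 - 1 / x) := by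
  rw [← measureReal_le_of_pareto hX hx.le]
  refine Eq.trans ?_ (measureReal_sign_inter hindep hB1 (measurableSet_Iic (a := x)))
  apply measureReal_congr
  filter_upwards [ae_one_lt_of_pareto hX] with ω hω
  refine propext (?_ : Y ω ≤ 2 - 1 / x ↔ B ω = 1 ∧ X ω ≤ x)
  have hX0 : 0 < X ω := by linarith
  have hx0 : 0 < x := by linarith
  have hXi : 0 < 1 / X ω := by positivity
  have hxi : 0 < 1 / x := by positivity
  rw [hY]
  rcases hBvals ω with hB | hB <;> rw [hB]
  · rw [neg_div]
    constructor
    · intro h; linarith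
    · rintro ⟨h, -⟩; norm_num at h
  · rw [sub_le_sub_iff_left, one_div_le_one_div hx0 hX0]
    simp

variable [IsProbabilityMeasure μ]

theorem measureReal_lt_of_pareto
    (hX : ∀ x : ℝ, μ {ω | X ω ≤ x} = if x < 1 then 0 else ENNReal.ofReal (1 - 1 / x))
    {x : ℝ} (hx : 1 < x) : μ.real {ω | X ω < x} = 1 - 1 / x := by
  apply le_antisymm
  · rw [← measureReal_le_of_pareto hX hx.le]
    exact measureReal_mono fun ω (hω : X ω < x) => hω.le
  · have hc : Tendsto (fun y : ℝ => 1 - 1 / y) (nhdsWithin x (Iio x)) (nhds (1 - 1 / x)) := by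
      have : ContinuousAt (fun y : ℝ => 1 - 1 / y) x := by
        have : x ≠ 0 := by linarith
        fun_prop (disch := assumption)
      exact this.tendsto.mono_left nhdsWithin_le_nhds
    refine le_of_tendsto hc ?_
    filter_upwards [Ioo_mem_nhdsLT hx] with y hy
    rw [← measureReal_le_of_pareto hX hy.1.le]
    exact measureReal_mono fun ω (hω : X ω ≤ y) => hω.trans_lt hy.2

theorem measureReal_gt_of_pareto (hXm : Measurable X)
    (hX : ∀ x : ℝ, μ {ω | X ω ≤ x} = if x < 1 then 0 else ENNReal.ofReal (1 - 1 / x))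
    {x : ℝ} (hx : 1 ≤ x) : μ.real {ω | x < X ω} = 1 / x := by
  have h := probReal_compl_eq_one_sub (μ := μ) (hXm (measurableSet_Iic (a := x)))
  have h' := measureReal_le_of_pareto hX hx
  have hs : {ω | x < X ω} = (X ⁻¹' Iic x)ᶜ := by ext; simp
  rw [hs, h]
  change 1 - μ.real {ω | X ω ≤ x} = _
  rw [h']
  ring

theorem cdf_two_add_inv (hXm : Measurable X) (hBm : Measurable B)
    (hX : ∀ x : ℝ, μ {ω | X ω ≤ x} = if x < 1 then 0 else ENNReal.ofReal (1 - 1 / x))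
    (hBvals : ∀ ω, B ω = -1 ∨ B ω = 1) (hBneg : μ {ω | B ω = -1} = 1 / 2)
    (hindep : IndepFun B X μ) (hY : ∀ ω, Y ω = 2 - B ω / X ω) {x : ℝ} (hx : 1 < x) :
    μ.real {ω | Y ω ≤ 2 + 1 / x} = 1 - 1 / 2 * (1 - 1 / x) := by
  rw [← measureReal_lt_of_pareto hX hx]
  have hm : MeasurableSet ({ω | B ω = -1} ∩ X ⁻¹' Iio x) :=
    (hBm (measurableSet_singleton (-1))).inter (hXm measurableSet_Iio)
  have h := probReal_compl_eq_one_sub (μ := μ) hm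
  rw [measureReal_sign_inter hindep hBneg measurableSet_Iio] at h
  refine Eq.trans ?_ h
  apply measureReal_congr
  filter_upwards [ae_one_lt_of_pareto hX] with ω hω
  refine propext (?_ : Y ω ≤ 2 + 1 / x ↔ ¬ (B ω = -1 ∧ X ω < x))
  have hX0 : 0 < X ω := by linarith
  have hx0 : 0 < x := by linarith
  have hXi : 0 < 1 / X ω := by positivity
  have hxi : 0 < 1 / x := by positivity
  rw [hY]
  rcases hBvals ω with hB | hB <;> rw [hB]
  · rw [neg_div, sub_neg_eq_add, add_le_add_iff_left, one_div_le_one_div hX0 hx0]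
    simp
  · constructor
    · rintro - ⟨h, -⟩; norm_num at h
    · intro; linarith

end Pareto

theorem stmt5 {Ω : Type*} [MeasurableSpace Ω] (μ : Measure Ω) [IsProbabilityMeasure μ]
    (X B : Ω → ℝ) (hXm : Measurable X) (hBm : Measurable B)
    (hX : ∀ x : ℝ, μ {ω | X ω ≤ x} = if x < 1 then 0 else ENNReal.ofReal (1 - 1 / x))
    (hBvals : ∀ ω, B ω = -1 ∨ B ω = 1)
    (hBneg : μ {ω | B ω = -1} = 1/2) (hB1 : μ {ω | B ω = 1} = 1/2)
    (hindep : IndepFun B X μ)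
    (Y : Ω → ℝ) (hY : ∀ ω, Y ω = 2 - B ω / X ω)
    (XL YL : Ω → ℝ)
    (hXL : ∀ ω, XL ω = lapInv (1 - 1 / X ω))
    (hYL : ∀ ω, YL ω = lapInv ((μ {ω' | Y ω' ≤ Y ω}).toReal)) :
    ∀ z : ℝ, z ≠ -(1/2) → z ≠ 1/2 →
      Tendsto (fun t : ℝ =>
          (μ ({ω | YL ω * Real.exp (XL ω) ≤ z} ∩ {ω | t < XL ω})).toReal
            / (μ {ω | t < XL ω}).toReal)
        atTop (nhds (if z < -(1/2) then 0 else if z < 1/2 then 1/2 else 1)) := by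
  intro z hz1 hz2
  have hpos : ∀ ω, 2 < X ω → B ω = 1 →
      YL ω * Real.exp (XL ω) = Real.log (1 - 1 / X ω) * (X ω / 2) := by
    intro ω hω hB
    have hc := cdf_two_sub_inv hX hBvals hB1 hindep hY (x := X ω) (by linarith)
    have hi : 0 < 1 / X ω := one_div_pos.2 (by linarith)
    rw [hYL, hXL, lapInv_one_sub_inv hω, Real.exp_log (by linarith), hY ω, hB]
    change lapInv (μ.real _) * _ = _
    rw [hc, lapInv, if_pos (by linarith)]
    congr 2
    ring
  have hneg : ∀ ω, 2 < X ω → B ω = -1 →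
      YL ω * Real.exp (XL ω) = -(Real.log (1 - 1 / X ω) * (X ω / 2)) := by
    intro ω hω hB
    have hc := cdf_two_add_inv hXm hBm hX hBvals hBneg hindep hY (x := X ω) (by linarith)
    have hi : 0 < 1 / X ω := one_div_pos.2 (by linarith)
    rw [hYL, hXL, lapInv_one_sub_inv hω, Real.exp_log (by linarith), hY ω, hB, neg_div,
      sub_neg_eq_add]
    change lapInv (μ.real _) * _ = _
    rw [hc, lapInv, if_neg (by linarith), neg_mul]
    congr 3
    ring
  have hexp : Tendsto (fun t : ℝ => 2 * Real.exp t) atTop atTop :=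
    Real.tendsto_exp_atTop.const_mul_atTop two_pos
  have hlt : ∀ᶠ x : ℝ in atTop,
      (Real.log (1 - 1 / x) * (x / 2) ≤ z ↔ -(1 / 2) < z) ∧
      (-(Real.log (1 - 1 / x) * (x / 2)) ≤ z ↔ 1 / 2 < z) := by
    have h1 := tendsto_half_mul_log_one_sub_inv
    have h2 := h1.neg
    rw [neg_neg] at h2
    have aux : ∀ {f : ℝ → ℝ} {a : ℝ}, Tendsto f atTop (nhds a) → z ≠ a →
        ∀ᶠ x in atTop, (f x ≤ z ↔ a < z) := by
      intro f a hf hza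
      rcases lt_or_gt_of_ne hza with h | h
      · filter_upwards [hf.eventually_const_lt h] with x hx
        exact iff_of_false hx.not_ge h.not_gt
      · filter_upwards [hf.eventually_lt_const h] with x hx
        exact iff_of_true hx.le h
    exact (aux h1 hz1).and (aux h2 hz2)
  obtain ⟨M, hM⟩ := eventually_atTop.1 hlt
  refine tendsto_const_nhds.congr' ?_
  filter_upwards [eventually_gt_atTop 0, hexp.eventually_ge_atTop M] with t ht htM
  have he : 1 ≤ Real.exp t := Real.one_le_exp ht.le
  have hden : {ω | t < XL ω} =ᵐ[μ] {ω | 2 * Real.exp t < X ω} := by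
    filter_upwards [ae_one_lt_of_pareto hX] with ω hω
    refine propext (?_ : t < XL ω ↔ 2 * Real.exp t < X ω)
    rw [hXL, lt_lapInv_iff hω ht.le]
  have hp : μ.real {ω | 2 * Real.exp t < X ω} ≠ 0 := by
    rw [measureReal_gt_of_pareto hXm hX (by linarith)]
    positivity
  have hnum : ({ω | YL ω * Real.exp (XL ω) ≤ z} ∩ {ω | t < XL ω} : Set Ω) =ᵐ[μ]
      {ω | (B ω = 1 ∧ -(1 / 2) < z ∨ B ω = -1 ∧ 1 / 2 < z) ∧ 2 * Real.exp t < X ω} := by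
    filter_upwards [ae_one_lt_of_pareto hX] with ω hω
    refine propext (?_ : (YL ω * Real.exp (XL ω) ≤ z ∧ t < XL ω) ↔
      (B ω = 1 ∧ -(1 / 2) < z ∨ B ω = -1 ∧ 1 / 2 < z) ∧ 2 * Real.exp t < X ω)
    rw [hXL, lt_lapInv_iff hω ht.le, ← hXL]
    refine and_congr_left fun h => ?_
    have hMx := hM (X ω) (by linarith)
    rcases hBvals ω with hB | hB
    · rw [hneg ω (by linarith) hB, hMx.2, hB]
      norm_num
    · rw [hpos ω (by linarith) hB, hMx.1, hB]
      norm_num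
  change _ = μ.real _ / μ.real _
  rw [measureReal_congr hden, measureReal_congr hnum, eq_div_iff hp]
  split_ifs with h1 h2
  · have h : {ω | (B ω = 1 ∧ -(1 / 2) < z ∨ B ω = -1 ∧ 1 / 2 < z) ∧ 2 * Real.exp t < X ω} = ∅ := by
      ext ω
      simp only [h1.not_gt, (by linarith : ¬ 1 / 2 < z), and_false, or_false, false_and,
        mem_ofPred_eq, mem_empty_iff_false]
    rw [h, measureReal_empty, zero_mul]
  · have h1' : -(1 / 2) < z := lt_of_le_of_ne (not_lt.1 h1) hz1.symm
    have h := measureReal_sign_inter hindep hB1 (measurableSet_Ioi (a := 2 * Real.exp t))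
    refine Eq.trans h.symm ?_
    congr 1
    ext ω
    simp [h1', h2.not_gt, -one_div]
  · have h2' : 1 / 2 < z := lt_of_le_of_ne (not_lt.1 h2) hz2.symm
    have h1' : -(1 / 2) < z := by linarith
    rw [one_mul]
    congr 1
    ext ω
    simp only [h1', h2', and_true, mem_ofPred_eq, (hBvals ω).symm, true_and]
end

section
/- Define g_c(u) = u(1 + c sin log u) for 0 < u ≤ 1 and |c| < 1/√2, and ψ_c(z) = g_c^{-1}(1/z) for z ≥ 1. Let Z_P be a standard Pareto random variable and B an independent random variable uniform on {1,2,3,4}, and define (X,Y) as: (2-ψ_{1/2}(Z_P), 2-1/Z_P) if B=1; (2-ψ_{-1/2}(Z_P), 2-1/√Z_P) if B=2; (1-1/Z_P, 2-1/Z_P) if B=3; (2-1/Z_P, 1-1/Z_P) if B=4. Then for every t with 1 < t < 2, P(B = 1 | X > t) = 1/3 + (1/6) sin log(2-t). Consequently P(B = 1 | X > t) does not converge as t → 2⁻: its limit inferior is 1/6 and its limit superior is 1/2. -/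
open MeasureTheory ProbabilityTheory Filter Set

/-- `g_c(u) = u (1 + c sin log u)`. -/
noncomputable def gc (c u : ℝ) : ℝ := u * (1 + c * Real.sin (Real.log u))

theorem gc_strictMonoOn {c : ℝ} (hc : |c| ≤ 1 / 2) : StrictMonoOn (gc c) (Ioi 0) := by
  have hderiv : ∀ u ∈ Ioi (0 : ℝ), HasDerivAt (gc c)
      (1 + c * (Real.sin (Real.log u) + Real.cos (Real.log u))) u := by
    intro u hu
    have hu0 : u ≠ 0 := ne_of_gt hu
    have h := (hasDerivAt_id u).mul
      ((((Real.hasDerivAt_log hu0).sin).const_mul c).const_add 1)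
    refine h.congr_deriv ?_
    simp only [id]
    field_simp
    ring
  refine strictMonoOn_of_deriv_pos (convex_Ioi 0)
    (fun u hu => (hderiv u hu).continuousAt.continuousWithinAt) fun u hu => ?_
  rw [interior_Ioi] at hu
  rw [(hderiv u hu).deriv]
  set a := Real.sin (Real.log u)
  set b := Real.cos (Real.log u)
  have hab : a ^ 2 + b ^ 2 = 1 := Real.sin_sq_add_cos_sq _
  have hlt : |a + b| < 2 := abs_lt.2 ⟨by nlinarith [sq_nonneg (a - b)],
    by nlinarith [sq_nonneg (a - b)]⟩
  have hmul : |c * (a + b)| < 1 := by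
    rw [abs_mul]
    nlinarith [abs_nonneg c, abs_nonneg (a + b)]
  linarith [(abs_lt.1 hmul).1]

theorem gc_one (c : ℝ) : gc c 1 = 1 := by simp [gc]

theorem gc_pos {c u : ℝ} (hc : |c| ≤ 1 / 2) (hu : 0 < u) : 0 < gc c u := by
  refine mul_pos hu ?_
  have hmul : |c * Real.sin (Real.log u)| < 1 := by
    rw [abs_mul]
    nlinarith [abs_nonneg c, Real.abs_sin_le_one (Real.log u),
      abs_nonneg (Real.sin (Real.log u))]
  linarith [(abs_lt.1 hmul).1]

/-- A right inverse `p` of `g_c` at `1 / z` lies below `s` exactly when `z` exceeds `1 / g_c(s)`. -/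
theorem lt_iff_one_div_gc_lt {c p s z : ℝ} (hc : |c| ≤ 1 / 2) (hs : 0 < s) (hp : 0 < p)
    (hz : 0 < z) (h : gc c p = 1 / z) : p < s ↔ 1 / gc c s < z := by
  rw [← (gc_strictMonoOn hc).lt_iff_lt hp hs, h]
  exact one_div_lt hz (gc_pos hc hs)

theorem one_le_one_div_gc {c s : ℝ} (hc : |c| ≤ 1 / 2) (hs : 0 < s) (hs1 : s < 1) :
    1 ≤ 1 / gc c s := by
  rw [le_div_iff₀ (gc_pos hc hs), one_mul, ← gc_one c]
  exact ((gc_strictMonoOn hc) hs (mem_Ioi.2 one_pos) hs1).le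

theorem pareto_measureReal_lt {Ω : Type*} [MeasurableSpace Ω] {μ : Measure Ω}
    [IsProbabilityMeasure μ] {Z : Ω → ℝ} (hZm : Measurable Z)
    (hZ : ∀ z : ℝ, μ {ω | Z ω ≤ z} = if z < 1 then 0 else ENNReal.ofReal (1 - 1 / z))
    {z : ℝ} (hz : 1 ≤ z) : μ.real {ω | z < Z ω} = 1 / z := by
  have hcompl : {ω | z < Z ω} = {ω | Z ω ≤ z}ᶜ := by
    ext ω
    simp
  have hle : 1 / z ≤ 1 := (div_le_one (by linarith)).2 hz
  rw [hcompl, probReal_compl_eq_one_sub (measurableSet_le hZm measurable_const), measureReal_def,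
    hZ, if_neg (not_lt.2 hz), ENNReal.toReal_ofReal (by linarith)]
  ring

theorem pareto_measureReal_inter {Ω : Type*} [MeasurableSpace Ω] {μ : Measure Ω}
    [IsProbabilityMeasure μ] {Z : Ω → ℝ} {B : Ω → ℕ} (hZm : Measurable Z)
    (hZ : ∀ z : ℝ, μ {ω | Z ω ≤ z} = if z < 1 then 0 else ENNReal.ofReal (1 - 1 / z))
    (hBunif : ∀ i : ℕ, 1 ≤ i → i ≤ 4 → μ {ω | B ω = i} = 1 / 4)
    (hindep : IndepFun B Z μ) {i : ℕ} (hi : 1 ≤ i) (hi' : i ≤ 4) {z : ℝ} (hz : 1 ≤ z) :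
    μ.real {ω | B ω = i ∧ z < Z ω} = 1 / z / 4 := by
  have h := hindep.measure_inter_preimage_eq_mul {i} (Ioi z) (measurableSet_singleton i)
    measurableSet_Ioi
  have hB : μ.real (B ⁻¹' {i}) = 1 / 4 := by
    change (μ {ω | B ω = i}).toReal = 1 / 4
    rw [hBunif i hi hi']
    norm_num
  have hZ' : μ.real (Z ⁻¹' Ioi z) = 1 / z := pareto_measureReal_lt hZm hZ hz
  have h' := congrArg ENNReal.toReal h
  rw [ENNReal.toReal_mul] at h'
  change μ.real (B ⁻¹' {i} ∩ Z ⁻¹' Ioi z) = _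
  rw [measureReal_def, h', ← measureReal_def, ← measureReal_def, hB, hZ']
  ring

theorem tendsto_two_sub_exp (a : ℝ) :
    Tendsto (fun n : ℕ => 2 - Real.exp (a - n * (2 * Real.pi))) atTop (nhdsWithin 2 (Iio 2)) := by
  refine tendsto_nhdsWithin_iff.2 ⟨?_, Eventually.of_forall fun n => ?_⟩
  · have hlin : Tendsto (fun n : ℕ => a - n * (2 * Real.pi)) atTop atBot := by
      simp only [sub_eq_add_neg]
      exact tendsto_atBot_add_const_left _ _ (tendsto_neg_atTop_atBot.comp
        (tendsto_natCast_atTop_atTop.atTop_mul_const (by positivity)))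
    simpa using (Real.tendsto_exp_atBot.comp hlin).const_sub 2
  · simpa using Real.exp_pos _

theorem frequently_sin_log_eq (a : ℝ) :
    ∃ᶠ t in nhdsWithin (2 : ℝ) (Iio 2), Real.sin (Real.log (2 - t)) = Real.sin a := by
  refine (tendsto_two_sub_exp a).frequently (Eventually.of_forall fun n => ?_).frequently
  rw [sub_sub_cancel, Real.log_exp, Real.sin_sub_nat_mul_two_pi]

theorem liminf_sin_log :
    liminf (fun t : ℝ => 1 / 3 + Real.sin (Real.log (2 - t)) / 6) (nhdsWithin 2 (Iio 2))
      = 1 / 6 := by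
  have hlow : ∀ t : ℝ, 1 / 6 ≤ 1 / 3 + Real.sin (Real.log (2 - t)) / 6 := fun t => by
    linarith [Real.neg_one_le_sin (Real.log (2 - t))]
  have hupp : ∀ t : ℝ, 1 / 3 + Real.sin (Real.log (2 - t)) / 6 ≤ 1 / 2 := fun t => by
    linarith [Real.sin_le_one (Real.log (2 - t))]
  refine le_antisymm ?_ ?_
  · refine liminf_le_of_frequently_le ?_ (isBoundedUnder_of ⟨1 / 6, hlow⟩)
    refine (frequently_sin_log_eq (-(Real.pi / 2))).mono fun t ht => ?_
    rw [ht, Real.sin_neg, Real.sin_pi_div_two]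
    norm_num
  · exact le_liminf_of_le (isBoundedUnder_of ⟨1 / 2, hupp⟩).isCoboundedUnder_ge
      (Eventually.of_forall hlow)

theorem limsup_sin_log :
    limsup (fun t : ℝ => 1 / 3 + Real.sin (Real.log (2 - t)) / 6) (nhdsWithin 2 (Iio 2))
      = 1 / 2 := by
  have hlow : ∀ t : ℝ, 1 / 6 ≤ 1 / 3 + Real.sin (Real.log (2 - t)) / 6 := fun t => by
    linarith [Real.neg_one_le_sin (Real.log (2 - t))]
  have hupp : ∀ t : ℝ, 1 / 3 + Real.sin (Real.log (2 - t)) / 6 ≤ 1 / 2 := fun t => by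
    linarith [Real.sin_le_one (Real.log (2 - t))]
  refine le_antisymm ?_ ?_
  · exact limsup_le_of_le (isBoundedUnder_of ⟨1 / 6, hlow⟩).isCoboundedUnder_le
      (Eventually.of_forall hupp)
  · refine le_limsup_of_frequently_le ?_ (isBoundedUnder_of ⟨1 / 2, hupp⟩)
    refine (frequently_sin_log_eq (Real.pi / 2)).mono fun t ht => ?_
    rw [ht, Real.sin_pi_div_two]
    norm_num

theorem stmt16 {Ω : Type*} [MeasurableSpace Ω] (μ : Measure Ω) [IsProbabilityMeasure μ]
    (Z : Ω → ℝ) (B : Ω → ℕ) (hZm : Measurable Z) (hBm : Measurable B)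
    (hZ : ∀ z : ℝ, μ {ω | Z ω ≤ z} = if z < 1 then 0 else ENNReal.ofReal (1 - 1 / z))
    (hBvals : ∀ ω, B ω = 1 ∨ B ω = 2 ∨ B ω = 3 ∨ B ω = 4)
    (hBunif : ∀ i : ℕ, 1 ≤ i → i ≤ 4 → μ {ω | B ω = i} = 1/4)
    (hindep : IndepFun B Z μ)
    (ψhalf ψneg : ℝ → ℝ)
    (hψhalf : ∀ z : ℝ, 1 ≤ z →
      0 < ψhalf z ∧ ψhalf z ≤ 1 ∧ gc (1/2) (ψhalf z) = 1 / z)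
    (hψneg : ∀ z : ℝ, 1 ≤ z →
      0 < ψneg z ∧ ψneg z ≤ 1 ∧ gc (-(1/2)) (ψneg z) = 1 / z)
    (X Y : Ω → ℝ)
    (hXdef : ∀ ω, X ω =
      if B ω = 1 then 2 - ψhalf (Z ω)
      else if B ω = 2 then 2 - ψneg (Z ω)
      else if B ω = 3 then 1 - 1 / Z ω
      else 2 - 1 / Z ω)
    (hYdef : ∀ ω, Y ω =
      if B ω = 2 then 2 - 1 / Real.sqrt (Z ω)
      else if B ω = 4 then 1 - 1 / Z ω
      else 2 - 1 / Z ω) :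
    ∀ f : ℝ → ℝ,
      (∀ t : ℝ, f t =
        (μ ({ω | B ω = 1} ∩ {ω | t < X ω})).toReal / (μ {ω | t < X ω}).toReal) →
      (∀ t : ℝ, 1 < t → t < 2 → f t = 1/3 + Real.sin (Real.log (2 - t)) / 6) ∧
      (¬ ∃ c : ℝ, Tendsto f (nhdsWithin 2 (Set.Iio 2)) (nhds c)) ∧
      Filter.liminf f (nhdsWithin 2 (Set.Iio 2)) = 1/6 ∧
      Filter.limsup f (nhdsWithin 2 (Set.Iio 2)) = 1/2 := by
  intro f hf
  have hformula : ∀ t : ℝ, 1 < t → t < 2 →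
      f t = 1/3 + Real.sin (Real.log (2 - t)) / 6 := by
    intro t ht1 ht2
    have hs : 0 < 2 - t := by linarith
    have hs1 : 2 - t < 1 := by linarith
    have hc : |(1 / 2 : ℝ)| ≤ 1 / 2 := by norm_num
    have hc' : |(-(1 / 2) : ℝ)| ≤ 1 / 2 := by norm_num
    have hZae : ∀ᵐ ω ∂μ, 1 < Z ω := by
      rw [ae_iff]
      simpa using hZ 1
    have hX1 : ∀ ω, 1 < Z ω → B ω = 1 → (t < X ω ↔ 1 / gc (1/2) (2 - t) < Z ω) := by
      intro ω hω hB
      obtain ⟨hpos, -, heq⟩ := hψhalf (Z ω) hω.le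
      rw [hXdef, if_pos hB, ← lt_iff_one_div_gc_lt hc hs hpos (by linarith) heq, lt_sub_comm]
    have hX2 : ∀ ω, 1 < Z ω → B ω = 2 → (t < X ω ↔ 1 / gc (-(1/2)) (2 - t) < Z ω) := by
      intro ω hω hB
      obtain ⟨hpos, -, heq⟩ := hψneg (Z ω) hω.le
      rw [hXdef, if_neg (by omega), if_pos hB,
        ← lt_iff_one_div_gc_lt hc' hs hpos (by linarith) heq, lt_sub_comm]
    have hX3 : ∀ ω, 1 < Z ω → B ω = 3 → ¬ t < X ω := by
      intro ω hω hB
      rw [hXdef, if_neg (by omega), if_neg (by omega), if_pos hB]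
      have : 0 < 1 / Z ω := one_div_pos.2 (by linarith)
      linarith
    have hX4 : ∀ ω, 1 < Z ω → B ω = 4 → (t < X ω ↔ 1 / (2 - t) < Z ω) := by
      intro ω hω hB
      rw [hXdef, if_neg (by omega), if_neg (by omega), if_neg (by omega), lt_sub_comm,
        one_div_lt (by linarith) hs]
    have hP := @pareto_measureReal_inter Ω _ μ _ Z B hZm hZ hBunif hindep
    have hnum : μ.real ({ω | B ω = 1} ∩ {ω | t < X ω}) = gc (1/2) (2 - t) / 4 := by
      have hset : ({ω | B ω = 1} ∩ {ω | t < X ω} : Set Ω) =ᵐ[μ]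
          {ω | B ω = 1 ∧ 1 / gc (1/2) (2 - t) < Z ω} := by
        filter_upwards [hZae] with ω hω
        exact propext (and_congr_right (hX1 ω hω))
      rw [measureReal_congr hset, hP (by norm_num) (by norm_num) (one_le_one_div_gc hc hs hs1),
        one_div_one_div]
    have hden : μ.real {ω | t < X ω} =
        gc (1/2) (2 - t) / 4 + gc (-(1/2)) (2 - t) / 4 + (2 - t) / 4 := by
      have hset : ({ω | t < X ω} : Set Ω) =ᵐ[μ]
          (({ω | B ω = 1 ∧ 1 / gc (1/2) (2 - t) < Z ω} ∪
            {ω | B ω = 2 ∧ 1 / gc (-(1/2)) (2 - t) < Z ω}) ∪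
            {ω | B ω = 4 ∧ 1 / (2 - t) < Z ω} : Set Ω) := by
        filter_upwards [hZae] with ω hω
        refine propext ?_
        change t < X ω ↔ ((B ω = 1 ∧ 1 / gc (1/2) (2 - t) < Z ω) ∨
          (B ω = 2 ∧ 1 / gc (-(1/2)) (2 - t) < Z ω)) ∨ (B ω = 4 ∧ 1 / (2 - t) < Z ω)
        rcases hBvals ω with h | h | h | h
        · simp [hX1 ω hω h, h]
        · simp [hX2 ω hω h, h]
        · simp [hX3 ω hω h, h]
        · simp [hX4 ω hω h, h]
      have hmeas : ∀ (i : ℕ) (z : ℝ), MeasurableSet {ω | B ω = i ∧ z < Z ω} := fun i z =>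
        (hBm (measurableSet_singleton i)).inter (hZm measurableSet_Ioi)
      rw [measureReal_congr hset, measureReal_union _ (hmeas _ _),
        measureReal_union _ (hmeas _ _),
        hP (by norm_num) (by norm_num) (one_le_one_div_gc hc hs hs1),
        hP (by norm_num) (by norm_num) (one_le_one_div_gc hc' hs hs1),
        hP (by norm_num) (by norm_num) ((one_le_div hs).2 hs1.le),
        one_div_one_div, one_div_one_div, one_div_one_div]
      · refine Set.disjoint_left.2 ?_
        rintro ω ⟨h, -⟩ ⟨h', -⟩
        omega
      · refine Set.disjoint_left.2 ?_
        rintro ω (⟨h, -⟩ | ⟨h, -⟩) ⟨h', -⟩ <;> omega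
    rw [hf, ← measureReal_def, ← measureReal_def, hnum, hden]
    have hsum : gc (1/2) (2 - t) / 4 + gc (-(1/2)) (2 - t) / 4 + (2 - t) / 4
        = 3 * (2 - t) / 4 := by
      unfold gc
      ring
    rw [hsum, gc]
    field_simp
    ring
  have hev : f =ᶠ[nhdsWithin 2 (Iio 2)]
      fun t => 1/3 + Real.sin (Real.log (2 - t)) / 6 := by
    filter_upwards [Ioo_mem_nhdsLT (show (1 : ℝ) < 2 by norm_num)] with t ht
    exact hformula t ht.1 ht.2
  have hinf := (liminf_congr hev).trans liminf_sin_log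
  have hsup := (limsup_congr hev).trans limsup_sin_log
  refine ⟨hformula, ?_, hinf, hsup⟩
  rintro ⟨c, hc⟩
  have h := hc.liminf_eq.symm.trans hinf
  have h' := hc.limsup_eq.symm.trans hsup
  norm_num [h] at h'
end
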